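/- Let r ≥ 2 and t ≥ 1 be integers with 2t + 1 ≠ r, let G be a finite simple r-regular graph, and let M be a set of 2t pairwise non-adjacent edges of G (no two edges of M share an endpoint). For each edge e ∈ M choose one endpoint a_e and let b_e be its other endpoint. Let G' be the graph obtained from G by deleting the edges of M, adding two new adjacent vertices w1 and w2, joining w1 to a_e for every e ∈ M, and joining w2 to b_e for every e ∈ M. Then G' has |V(G)| + 2 vertices, the vertices w1 and w2 each have degree 2t + 1 in G', and every other vertex of G' has degree r; in particular, the degree set of G' is {r, 2t+1}. -/

import Mathlib

/-- The graph obtained from `G` by deleting the edges in `M`, adding two new adjacent vertices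
`w₁ = Sum.inr false` and `w₂ = Sum.inr true`, joining `w₁` to the chosen endpoint `a e` of each
edge `e ∈ M`, and joining `w₂` to the other endpoint `b e` of each edge `e ∈ M`. -/
def addTwoOddVertices {V : Type*} (G : SimpleGraph V) (M : Finset (Sym2 V))
    (a b : Sym2 V → V) : SimpleGraph (V ⊕ Bool) :=
  SimpleGraph.fromRel fun x y =>
    match x, y with
    | Sum.inl p, Sum.inl q => G.Adj p q ∧ s(p, q) ∉ M
    | Sum.inl p, Sum.inr w => (w = false ∧ ∃ e ∈ M, p = a e) ∨ (w = true ∧ ∃ e ∈ M, p = b e)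
    | Sum.inr w, Sum.inr w' => w = false ∧ w' = true
    | _, _ => False

theorem addTwo_inl_inl {V : Type*} (G : SimpleGraph V) (M : Finset (Sym2 V))
    (a b : Sym2 V → V) (p q : V) :
    (addTwoOddVertices G M a b).Adj (Sum.inl p) (Sum.inl q) ↔ G.Adj p q ∧ s(p, q) ∉ M := by
  simp only [addTwoOddVertices, SimpleGraph.fromRel_adj]
  constructor
  · rintro ⟨_, h | h⟩
    · exact h
    · exact ⟨h.1.symm, by rw [Sym2.eq_swap]; exact h.2⟩
  · intro h
    exact ⟨by simpa using h.1.ne, Or.inl h⟩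

theorem addTwo_inl_false {V : Type*} (G : SimpleGraph V) (M : Finset (Sym2 V))
    (a b : Sym2 V → V) (p : V) :
    (addTwoOddVertices G M a b).Adj (Sum.inl p) (Sum.inr false) ↔ ∃ e ∈ M, p = a e := by
  simp [addTwoOddVertices, SimpleGraph.fromRel_adj]

theorem addTwo_inl_true {V : Type*} (G : SimpleGraph V) (M : Finset (Sym2 V))
    (a b : Sym2 V → V) (p : V) :
    (addTwoOddVertices G M a b).Adj (Sum.inl p) (Sum.inr true) ↔ ∃ e ∈ M, p = b e := by
  simp [addTwoOddVertices, SimpleGraph.fromRel_adj]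

theorem addTwo_inr {V : Type*} (G : SimpleGraph V) (M : Finset (Sym2 V))
    (a b : Sym2 V → V) (w w' : Bool) :
    (addTwoOddVertices G M a b).Adj (Sum.inr w) (Sum.inr w') ↔ w ≠ w' := by
  cases w <;> cases w' <;> simp [addTwoOddVertices, SimpleGraph.fromRel_adj]

theorem addTwo_ncard_new {V : Type*} [Fintype V] (M : Finset (Sym2 V)) (c : Sym2 V → V)
    (hMdisj : ∀ e ∈ M, ∀ f ∈ M, e ≠ f → ∀ x : V, x ∈ e → x ∉ f)
    (hc : ∀ e ∈ M, c e ∈ e) (w : Bool) :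
    (insert (Sum.inr w) (Sum.inl '' (c '' (M : Set (Sym2 V)))) : Set (V ⊕ Bool)).ncard
      = M.card + 1 := by
  rw [Set.ncard_insert_of_notMem (by simp) (Set.toFinite _),
    Set.ncard_image_of_injective _ Sum.inl_injective, Set.ncard_image_of_injOn,
    Set.ncard_coe_finset]
  intro e he f hf h
  by_contra hne
  exact hMdisj e he f hf hne (c e) (hc e he) (by rw [h]; exact hc f hf)

theorem addTwo_ncard_old {V : Type*} [Fintype V] (s : Set V) (q : V) (hq : q ∈ s) (w : Bool) :
    (insert (Sum.inr w) (Sum.inl '' (s \ {q})) : Set (V ⊕ Bool)).ncard = s.ncard := by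
  rw [Set.ncard_insert_of_notMem (by simp) (Set.toFinite _),
    Set.ncard_image_of_injective _ Sum.inl_injective]
  exact Set.ncard_diff_singleton_add_one hq (Set.toFinite _)

/-- Let `r ≥ 2`, `t ≥ 1` with `2t + 1 ≠ r`, `G` a finite simple `r`-regular graph,
and `M` a set of `2t` pairwise non-adjacent edges of `G`; for `e ∈ M` let `a e` and `b e` be its
two (distinct) endpoints. Then the graph `G'` obtained by deleting the edges of `M`, adding two
new adjacent vertices `w₁, w₂`, joining `w₁` to `a e` and `w₂` to `b e` for every `e ∈ M`, has
`|V(G)| + 2` vertices, `w₁` and `w₂` each have degree `2t + 1`, every other vertex has degree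
`r`, and the degree set of `G'` is `{r, 2t + 1}`. -/
theorem stmt_11 {V : Type*} [Fintype V] (r t : ℕ) (hr : 2 ≤ r) (ht : 1 ≤ t)
    (hrt : 2 * t + 1 ≠ r)
    (G : SimpleGraph V) (hreg : ∀ v : V, (G.neighborSet v).ncard = r)
    (M : Finset (Sym2 V)) (hME : ↑M ⊆ G.edgeSet) (hMcard : M.card = 2 * t)
    (hMdisj : ∀ e ∈ M, ∀ f ∈ M, e ≠ f → ∀ x : V, x ∈ e → x ∉ f)
    (a b : Sym2 V → V)
    (hab : ∀ e ∈ M, a e ∈ e ∧ b e ∈ e ∧ a e ≠ b e) :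
    Nat.card (V ⊕ Bool) = Fintype.card V + 2 ∧
    ((addTwoOddVertices G M a b).neighborSet (Sum.inr false)).ncard = 2 * t + 1 ∧
    ((addTwoOddVertices G M a b).neighborSet (Sum.inr true)).ncard = 2 * t + 1 ∧
    (∀ p : V, ((addTwoOddVertices G M a b).neighborSet (Sum.inl p)).ncard = r) ∧
    {d : ℕ | ∃ x : V ⊕ Bool, ((addTwoOddVertices G M a b).neighborSet x).ncard = d}
      = {r, 2 * t + 1} := by
  have huniq : ∀ e ∈ M, ∀ f ∈ M, ∀ x : V, x ∈ e → x ∈ f → e = f := by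
    intro e he f hf x hx hx'
    by_contra hne
    exact hMdisj e he f hf hne x hx hx'
  have hs : ∀ e ∈ M, e = s(a e, b e) := fun e he =>
    (Sym2.mem_and_mem_iff (hab e he).2.2).1 ⟨(hab e he).1, (hab e he).2.1⟩
  have hf : ((addTwoOddVertices G M a b).neighborSet (Sum.inr false)).ncard = 2 * t + 1 := by
    rw [← hMcard, ← addTwo_ncard_new M a hMdisj (fun e he => (hab e he).1) true]
    congr 1
    ext x
    rcases x with p | w
    · rw [SimpleGraph.mem_neighborSet, SimpleGraph.adj_comm, addTwo_inl_false]
      simp [eq_comm]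
    · rw [SimpleGraph.mem_neighborSet, addTwo_inr]
      cases w <;> simp
  have htr : ((addTwoOddVertices G M a b).neighborSet (Sum.inr true)).ncard = 2 * t + 1 := by
    rw [← hMcard, ← addTwo_ncard_new M b hMdisj (fun e he => (hab e he).2.1) false]
    congr 1
    ext x
    rcases x with p | w
    · rw [SimpleGraph.mem_neighborSet, SimpleGraph.adj_comm, addTwo_inl_true]
      simp [eq_comm]
    · rw [SimpleGraph.mem_neighborSet, addTwo_inr]
      cases w <;> simp
  have hold : ∀ p : V, ((addTwoOddVertices G M a b).neighborSet (Sum.inl p)).ncard = r := by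
    intro p
    by_cases hp : ∃ e ∈ M, p ∈ e
    · obtain ⟨e, he, hpe⟩ := hp
      have hse := hs e he
      have hadj : G.Adj (a e) (b e) := by
        have h := hME he
        rw [hse] at h
        exact h
      have hpe' := hpe
      rw [hse, Sym2.mem_iff] at hpe'
      rcases hpe' with h | h
      · have hMq : ∀ q, s(p, q) ∈ M ↔ q = b e := by
          intro q
          constructor
          · intro hq
            have := huniq _ hq e he p (by simp) hpe
            rw [hse, h] at this
            exact Sym2.congr_right.1 this
          · rintro rfl
            rw [h, ← hse]; exact he
        rw [← hreg p, ← addTwo_ncard_old (G.neighborSet p) (b e) (by rw [h]; exact hadj) false]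
        congr 1
        ext x
        rcases x with q | w
        · rw [SimpleGraph.mem_neighborSet, addTwo_inl_inl, hMq]
          simp
        · cases w
          · rw [SimpleGraph.mem_neighborSet, addTwo_inl_false]
            simpa using ⟨e, he, h⟩
          · rw [SimpleGraph.mem_neighborSet, addTwo_inl_true]
            simp only [Set.mem_insert_iff, Sum.inr.injEq, Set.mem_image, reduceCtorEq, and_false,
              exists_false, or_false, Bool.true_eq_false, iff_false]
            rintro ⟨f, hf, hpf⟩
            have := huniq e he f hf p hpe (by rw [hpf]; exact (hab f hf).2.1)
            subst this
            exact (hab e he).2.2 (h.symm.trans hpf)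
      · have hMq : ∀ q, s(p, q) ∈ M ↔ q = a e := by
          intro q
          constructor
          · intro hq
            have := huniq _ hq e he p (by simp) hpe
            rw [hse, h, Sym2.eq_swap (a := a e)] at this
            exact Sym2.congr_right.1 this
          · rintro rfl
            rw [h, Sym2.eq_swap, ← hse]; exact he
        rw [← hreg p, ← addTwo_ncard_old (G.neighborSet p) (a e)
          (by rw [h]; exact hadj.symm) true]
        congr 1
        ext x
        rcases x with q | w
        · rw [SimpleGraph.mem_neighborSet, addTwo_inl_inl, hMq]
          simp
        · cases w
          · rw [SimpleGraph.mem_neighborSet, addTwo_inl_false]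
            simp only [Set.mem_insert_iff, Sum.inr.injEq, Set.mem_image, reduceCtorEq, and_false,
              exists_false, or_false, Bool.false_eq_true, iff_false]
            rintro ⟨f, hf, hpf⟩
            have := huniq e he f hf p hpe (by rw [hpf]; exact (hab f hf).1)
            subst this
            exact (hab e he).2.2 (hpf.symm.trans h)
          · rw [SimpleGraph.mem_neighborSet, addTwo_inl_true]
            simpa using ⟨e, he, h⟩
    · push Not at hp
      rw [← hreg p, ← Set.ncard_image_of_injective (G.neighborSet p)
        (Sum.inl_injective (β := Bool))]
      congr 1
      ext x
      rcases x with q | w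
      · rw [SimpleGraph.mem_neighborSet, addTwo_inl_inl]
        have : s(p, q) ∉ M := fun h => hp _ h (by simp)
        simp [this]
      · cases w
        · rw [SimpleGraph.mem_neighborSet, addTwo_inl_false]
          simp only [Set.mem_image, reduceCtorEq, and_false, exists_false, iff_false]
          rintro ⟨f, hf, hpf⟩
          exact hp f hf (by rw [hpf]; exact (hab f hf).1)
        · rw [SimpleGraph.mem_neighborSet, addTwo_inl_true]
          simp only [Set.mem_image, reduceCtorEq, and_false, exists_false, iff_false]
          rintro ⟨f, hf, hpf⟩
          exact hp f hf (by rw [hpf]; exact (hab f hf).2.1)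
  refine ⟨by simp, hf, htr, hold, ?_⟩
  have hne : M.Nonempty := Finset.card_pos.1 (by omega)
  obtain ⟨e, he⟩ := hne
  ext d
  simp only [Set.mem_setOf_eq, Set.mem_insert_iff, Set.mem_singleton_iff]
  constructor
  · rintro ⟨x, rfl⟩
    rcases x with p | w
    · exact Or.inl (hold p)
    · cases w
      · exact Or.inr hf
      · exact Or.inr htr
  · rintro (rfl | rfl)
    · exact ⟨Sum.inl (a e), hold _⟩
    · exact ⟨Sum.inr false, hf⟩
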